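/- (Sublinear convergence rate.) Let f, g, h : ℝ^p → ℝ be convex with f differentiable and L_f-smooth. Let (γ_t), (x_t), (z_t), (u_t) be adaptive three-operator-splitting iterates with δ_t ≥ 0 for all t ≥ 0, and suppose for each t ≥ 1 at least one of the following holds: (a) γ_t ≤ γ_{t−1}; or (b) h is β_h-Lipschitz for some β_h > 0, ‖u_0‖ ≤ β_h, and γ_t² ≤ γ_{t−1}² + γ_{t−1} δ_{t−1}/(4β_h²). For t ≥ 0 set S_t = Σ_{i=0}^{t} γ_i, x̄_{t+1} = S_t^{−1} Σ_{i=0}^{t} γ_i x_{i+1}, and ū_{t+1} = S_t^{−1} Σ_{i=0}^{t} γ_i u_{i+1}. Then for every t ≥ 0 and every x, u ∈ ℝ^p with h*(u) < +∞ (note that h*(ū_{t+1}) < +∞ automatically): L(x̄_{t+1}, u) − L(x, ū_{t+1}) ≤ (‖z_0 − x‖² + γ_0² ‖u_0 − u‖²)/(2 S_t), where L(x,u) = f(x) + g(x) + ⟨x,u⟩ − h*(u). -/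

import Mathlib

open scoped RealInnerProductSpace

/-- `z` is the proximal point `prox_{γ φ}(x)`. -/
def IsProx {p : ℕ} (φ : EuclideanSpace ℝ (Fin p) → ℝ) (γ : ℝ)
    (x z : EuclideanSpace ℝ (Fin p)) : Prop :=
  ∀ y, φ z + ‖x - z‖ ^ 2 / (2 * γ) ≤ φ y + ‖x - y‖ ^ 2 / (2 * γ)

/-- The Fenchel conjugate `φ*(u) = sup_x (⟨x, u⟩ - φ(x))`, valued in `ℝ ∪ {+∞}`
(modelled by `EReal`). -/
noncomputable def fenchel {p : ℕ} (φ : EuclideanSpace ℝ (Fin p) → ℝ)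
    (u : EuclideanSpace ℝ (Fin p)) : EReal :=
  ⨆ x, ((⟪x, u⟫ - φ x : ℝ) : EReal)

/-- The saddle-point Lagrangian `L(x, u) = f(x) + g(x) + ⟨x, u⟩ - h*(u)`
(its real value, meaningful whenever `h*(u) < +∞`). -/
noncomputable def saddleL {p : ℕ} (f g h : EuclideanSpace ℝ (Fin p) → ℝ)
    (x u : EuclideanSpace ℝ (Fin p)) : ℝ :=
  f x + g x + ⟪x, u⟫ - (fenchel h u).toReal

theorem aux_prox {p : ℕ} (φ : EuclideanSpace ℝ (Fin p) → ℝ) (hφ : ConvexOn ℝ Set.univ φ)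
    (γ : ℝ) (hγ : 0 < γ) (x z : EuclideanSpace ℝ (Fin p)) (h : IsProx φ γ x z)
    (y : EuclideanSpace ℝ (Fin p)) : γ * φ z + ⟪x - z, y - z⟫ ≤ γ * φ y := by
  by_contra! hcon
  set e := γ * φ z + ⟪x - z, y - z⟫ - γ * φ y with he
  have hepos : 0 < e := by linarith
  have hC : 0 ≤ ‖y - z‖ ^ 2 := by positivity
  have key : ∀ s : ℝ, 0 < s → s ≤ 1 → e ≤ s * ‖y - z‖ ^ 2 / 2 := by
    intro s hs hs1
    have h1 := h (z + s • (y - z))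
    have h2 := hφ.2 (Set.mem_univ z) (Set.mem_univ y) (by linarith : 0 ≤ 1 - s) hs.le (by ring)
    have h3 : (1 - s) • z + s • y = z + s • (y - z) := by module
    rw [h3] at h2
    simp only [smul_eq_mul] at h2
    have h4 : x - (z + s • (y - z)) = (x - z) - s • (y - z) := by module
    rw [h4, norm_sub_sq_real (x - z) (s • (y - z)), inner_smul_right, norm_smul, mul_pow,
      Real.norm_eq_abs, sq_abs] at h1
    have h5 : φ z + ‖x - z‖ ^ 2 / (2 * γ) ≤ ((1 - s) * φ z + s * φ y) +
        (‖x - z‖ ^ 2 - 2 * (s * ⟪x - z, y - z⟫) + s ^ 2 * ‖y - z‖ ^ 2) / (2 * γ) := by linarith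
    have h6 : s * e ≤ s * (s * ‖y - z‖ ^ 2 / 2) := by
      have h7 := mul_le_mul_of_nonneg_right h5 (by positivity : 0 ≤ γ)
      have e1 : (φ z + ‖x - z‖ ^ 2 / (2 * γ)) * γ = φ z * γ + ‖x - z‖ ^ 2 / 2 := by field_simp
      have e2 : (((1 - s) * φ z + s * φ y) +
        (‖x - z‖ ^ 2 - 2 * (s * ⟪x - z, y - z⟫) + s ^ 2 * ‖y - z‖ ^ 2) / (2 * γ)) * γ =
        ((1 - s) * φ z + s * φ y) * γ +
        (‖x - z‖ ^ 2 - 2 * (s * ⟪x - z, y - z⟫) + s ^ 2 * ‖y - z‖ ^ 2) / 2 := by field_simp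
      rw [e1, e2] at h7
      rw [he]
      linarith
    exact le_of_mul_le_mul_left h6 hs
  have := key (e / (e + ‖y - z‖ ^ 2)) (by positivity) (by rw [div_le_one (by positivity)]; linarith)
  have h8 : e / (e + ‖y - z‖ ^ 2) * ‖y - z‖ ^ 2 ≤ e := by
    rw [div_mul_eq_mul_div, div_le_iff₀ (by positivity)]
    nlinarith
  linarith

theorem aux_grad {p : ℕ} (f : EuclideanSpace ℝ (Fin p) → ℝ) (hf : ConvexOn ℝ Set.univ f)
    (z d : EuclideanSpace ℝ (Fin p)) (hd : HasGradientAt f d z)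
    (y : EuclideanSpace ℝ (Fin p)) : f z + ⟪d, y - z⟫ ≤ f y := by
  have h1 : HasDerivAt (fun s : ℝ => z + s • (y - z)) (y - z) 0 := by
    simpa using ((hasDerivAt_id (0:ℝ)).smul_const (y - z)).const_add z
  have h2 : HasDerivAt (fun s : ℝ => f (z + s • (y - z))) ⟪d, y - z⟫ 0 := by
    have h3 : HasFDerivAt f (InnerProductSpace.toDual ℝ _ d) (z + (0:ℝ) • (y - z)) := by
      simpa using hd.hasFDerivAt
    have h6 := h3.comp_hasDerivAt (0:ℝ) h1
    rw [InnerProductSpace.toDual_apply_apply] at h6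
    exact h6
  have h4 : ConvexOn ℝ Set.univ (fun s : ℝ => f (z + s • (y - z))) := by
    refine ⟨convex_univ, fun a _ b _ r s hr hs hrs => ?_⟩
    have := hf.2 (Set.mem_univ (z + a • (y - z))) (Set.mem_univ (z + b • (y - z))) hr hs hrs
    convert this using 2
    have : r = 1 - s := by linarith
    subst this
    simp only [smul_eq_mul]
    module
  have h5 := h4.le_slope_of_hasDerivAt (Set.mem_univ 0) (Set.mem_univ 1) one_pos h2
  simp [slope_def_field] at h5
  linarith

theorem aux_lip {p : ℕ} (h : EuclideanSpace ℝ (Fin p) → ℝ) (β C : ℝ)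
    (hβ : 0 < β) (hL : ∀ a b, |h a - h b| ≤ β * ‖a - b‖) (v : EuclideanSpace ℝ (Fin p))
    (hv : ∀ y, ⟪y, v⟫ - h y ≤ C) : ‖v‖ ≤ β := by
  by_contra! hc
  have hv0 : 0 < ‖v‖ := by linarith
  have hd : 0 < ‖v‖ * (‖v‖ - β) := mul_pos hv0 (by linarith)
  set s := (|C + h 0| + 1) / (‖v‖ * (‖v‖ - β)) with hs
  have hspos : 0 < s := by positivity
  have h1 := hv (s • v)
  have h2 := (abs_le.1 (hL (s • v) 0)).2
  rw [sub_zero, norm_smul, Real.norm_of_nonneg hspos.le] at h2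
  rw [real_inner_smul_left, real_inner_self_eq_norm_sq] at h1
  have h3 : s * (‖v‖ * (‖v‖ - β)) = |C + h 0| + 1 := by rw [hs]; field_simp
  have h4 := le_abs_self (C + h 0)
  nlinarith

theorem aux_step {p : ℕ} (γ δ fx fz gx fy gy Hu Hv hz : ℝ) (hγ : 0 < γ)
    (x z z' u u' d y v : EuclideanSpace ℝ (Fin p))
    (hx : x = z' + γ • (u' - u))
    (hg : γ * gx + ⟪(z - γ • u - γ • d) - x, y - x⟫ ≤ γ * gy)
    (hf : fz + ⟪d, y - z⟫ ≤ fy)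
    (hδ : δ = fz + ⟪d, x - z⟫ + ‖x - z‖ ^ 2 / (2 * γ) - fx)
    (hHu : Hu = ⟪z', u'⟫ - hz) (hHv : ⟪z', v⟫ - hz ≤ Hv) :
    γ * ((fx + gx + ⟪x, v⟫ - Hv) - (fy + gy + ⟪y, u'⟫ - Hu)) ≤
      (‖z - y‖ ^ 2 - ‖z' - y‖ ^ 2) / 2 + γ ^ 2 * (‖u - v‖ ^ 2 - ‖u' - v‖ ^ 2) / 2 - γ * δ := by
  have hδ' : γ * δ = γ * (fz + ⟪d, x - z⟫) + ‖x - z‖ ^ 2 / 2 - γ * fx := by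
    rw [hδ]; field_simp
  have hf2 := mul_le_mul_of_nonneg_left hf hγ.le
  have hH2 := mul_le_mul_of_nonneg_left hHv hγ.le
  have id : γ * (⟪d, x - z⟫ - ⟪d, y - z⟫) + ‖x - z‖ ^ 2 / 2
      - ⟪(z - γ • u - γ • d) - x, y - x⟫ + γ * (⟪x, v⟫ - ⟪y, u'⟫ + ⟪z', u'⟫ - ⟪z', v⟫)
      = (‖z - y‖ ^ 2 - ‖z' - y‖ ^ 2) / 2 + γ ^ 2 * (‖u - v‖ ^ 2 - ‖u' - v‖ ^ 2) / 2 := by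
    subst hx
    simp only [← real_inner_self_eq_norm_sq, inner_sub_left, inner_sub_right, inner_add_left,
      inner_add_right, real_inner_smul_left, real_inner_smul_right]
    simp only [real_inner_comm]
    ring
  subst hHu
  nlinarith

theorem aux_fenchel_le {p : ℕ} (h : EuclideanSpace ℝ (Fin p) → ℝ)
    (v : EuclideanSpace ℝ (Fin p)) (C : ℝ) (hv : ∀ y, ⟪y, v⟫ - h y ≤ C) :
    (fenchel h v).toReal ≤ C := by
  have h1 : fenchel h v ≤ (C : EReal) := iSup_le fun y => EReal.coe_le_coe_iff.2 (hv y)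
  have h2 : ((⟪(0 : EuclideanSpace ℝ (Fin p)), v⟫ - h 0 : ℝ) : EReal) ≤ fenchel h v :=
    le_iSup (fun y => ((⟪y, v⟫ - h y : ℝ) : EReal)) 0
  have h3 : fenchel h v ≠ ⊥ := fun hb => by
    rw [hb, le_bot_iff] at h2
    exact EReal.coe_ne_bot _ h2
  simpa using EReal.toReal_le_toReal h1 h3 (EReal.coe_ne_top C)

theorem aux_le_fenchel {p : ℕ} (h : EuclideanSpace ℝ (Fin p) → ℝ)
    (v : EuclideanSpace ℝ (Fin p)) (hv : fenchel h v < ⊤) (y : EuclideanSpace ℝ (Fin p)) :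
    ⟪y, v⟫ - h y ≤ (fenchel h v).toReal := by
  have h2 : ((⟪y, v⟫ - h y : ℝ) : EReal) ≤ fenchel h v :=
    le_iSup (fun y => ((⟪y, v⟫ - h y : ℝ) : EReal)) y
  have h3 := EReal.toReal_le_toReal h2 (EReal.coe_ne_bot _) hv.ne
  rwa [EReal.toReal_coe] at h3

/-- **Sublinear convergence rate** of the adaptive three operator splitting
in terms of the saddle-point suboptimality of the weighted ergodic iterates
(`γ (t-1)` for `t = 0` is `γ 0` by truncated subtraction, implementing the
convention `γ₋₁ = γ₀`). -/
theorem sublinear_convergence_rate {p : ℕ}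
    (f g h : EuclideanSpace ℝ (Fin p) → ℝ)
    (f' : EuclideanSpace ℝ (Fin p) → EuclideanSpace ℝ (Fin p))
    (L_f : ℝ)
    (hf : ConvexOn ℝ Set.univ f) (hg : ConvexOn ℝ Set.univ g)
    (hh : ConvexOn ℝ Set.univ h)
    (hf' : ∀ w, HasGradientAt f (f' w) w)
    (hsmooth : ∀ a b, ‖f' a - f' b‖ ≤ L_f * ‖a - b‖)
    (γ : ℕ → ℝ) (x z u : ℕ → EuclideanSpace ℝ (Fin p)) (δ : ℕ → ℝ)
    (hγpos : ∀ t, 0 < γ t)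
    (hx : ∀ t, IsProx g (γ t) (z t - γ t • u t - γ t • f' (z t)) (x (t + 1)))
    (hz : ∀ t, IsProx h (γ t) (x (t + 1) + γ t • u t) (z (t + 1)))
    (hu : ∀ t, u (t + 1) = u t + (γ t)⁻¹ • (x (t + 1) - z (t + 1)))
    (hδ : ∀ t, δ t = f (z t) + ⟪f' (z t), x (t + 1) - z t⟫ +
      ‖x (t + 1) - z t‖ ^ 2 / (2 * γ t) - f (x (t + 1)))
    (hδpos : ∀ t, 0 ≤ δ t)
    (hstep : ∀ t, 1 ≤ t → γ t ≤ γ (t - 1) ∨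
      ∃ β_h > (0 : ℝ), (∀ a b, |h a - h b| ≤ β_h * ‖a - b‖) ∧ ‖u 0‖ ≤ β_h ∧
        γ t ^ 2 ≤ γ (t - 1) ^ 2 + γ (t - 1) * δ (t - 1) / (4 * β_h ^ 2)) :
    ∀ (t : ℕ) (xx uu : EuclideanSpace ℝ (Fin p)), fenchel h uu < ⊤ →
      saddleL f g h
          ((∑ i ∈ Finset.range (t + 1), γ i)⁻¹ •
            ∑ i ∈ Finset.range (t + 1), γ i • x (i + 1)) uu -
        saddleL f g h xx
          ((∑ i ∈ Finset.range (t + 1), γ i)⁻¹ •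
            ∑ i ∈ Finset.range (t + 1), γ i • u (i + 1)) ≤
      (‖z 0 - xx‖ ^ 2 + (γ 0) ^ 2 * ‖u 0 - uu‖ ^ 2) /
        (2 * ∑ i ∈ Finset.range (t + 1), γ i) := by
  intro t xx uu huu
  set Hv := (fenchel h uu).toReal with hHv
  have hv := aux_le_fenchel h uu huu
  -- subgradient of h
  have hxz : ∀ i, x (i + 1) = z (i + 1) + γ i • (u (i + 1) - u i) := by
    intro i
    rw [hu i, add_sub_cancel_left, smul_smul, mul_inv_cancel₀ (hγpos i).ne', one_smul]
    abel
  have hsub : ∀ i y, ⟪y, u (i + 1)⟫ - h y ≤ ⟪z (i + 1), u (i + 1)⟫ - h (z (i + 1)) := by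
    intro i y
    have h1 := aux_prox h hh (γ i) (hγpos i) _ _ (hz i) y
    have h2 : x (i + 1) + γ i • u i - z (i + 1) = γ i • u (i + 1) := by
      rw [hxz i]; module
    rw [h2, real_inner_smul_left, ← mul_add] at h1
    have h3 := le_of_mul_le_mul_left h1 (hγpos i)
    rw [inner_sub_right, real_inner_comm, real_inner_comm (z (i + 1))] at h3
    linarith
  have hone : ∀ i, γ i * ((f (x (i + 1)) + g (x (i + 1)) + ⟪x (i + 1), uu⟫ - Hv) -
      (f xx + g xx + ⟪xx, u (i + 1)⟫ - (⟪z (i + 1), u (i + 1)⟫ - h (z (i + 1))))) ≤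
      (‖z i - xx‖ ^ 2 - ‖z (i + 1) - xx‖ ^ 2) / 2 +
        γ i ^ 2 * (‖u i - uu‖ ^ 2 - ‖u (i + 1) - uu‖ ^ 2) / 2 - γ i * δ i := fun i =>
    aux_step (γ i) (δ i) _ (f (z i)) _ _ _ _ Hv (h (z (i + 1))) (hγpos i) _ _ _ _ _ (f' (z i)) _ _
      (hxz i) (aux_prox g hg (γ i) (hγpos i) _ _ (hx i) xx)
      (aux_grad f hf _ _ (hf' (z i)) xx) (hδ i) rfl (hv _)
  have hst : ∀ i, γ (i + 1) ^ 2 * ‖u (i + 1) - uu‖ ^ 2 ≤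
      γ i ^ 2 * ‖u (i + 1) - uu‖ ^ 2 + 2 * (γ i * δ i) := by
    intro i
    have hgd : 0 ≤ γ i * δ i := mul_nonneg (hγpos i).le (hδpos i)
    rcases hstep (i + 1) (by omega) with hle | ⟨β, hβ, hL, -, hb⟩
    · rw [Nat.add_sub_cancel] at hle
      have : γ (i + 1) ^ 2 ≤ γ i ^ 2 := pow_le_pow_left₀ (hγpos _).le hle 2
      have := mul_le_mul_of_nonneg_right this (sq_nonneg ‖u (i + 1) - uu‖)
      linarith
    · rw [Nat.add_sub_cancel] at hb
      have h1 := aux_lip h β _ hβ hL _ (hsub i)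
      have h2 := aux_lip h β _ hβ hL _ hv
      have h3 : ‖u (i + 1) - uu‖ ≤ 2 * β := (norm_sub_le _ _).trans (by linarith)
      have h4 : ‖u (i + 1) - uu‖ ^ 2 ≤ 4 * β ^ 2 :=
        (pow_le_pow_left₀ (norm_nonneg _) h3 2).trans (by linarith)
      have h5 := mul_le_mul_of_nonneg_right hb (sq_nonneg ‖u (i + 1) - uu‖)
      have h6 : γ i * δ i / (4 * β ^ 2) * ‖u (i + 1) - uu‖ ^ 2 ≤ γ i * δ i := by
        rw [div_mul_eq_mul_div, div_le_iff₀ (by positivity)]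
        exact mul_le_mul_of_nonneg_left h4 hgd
      linarith
  have hsum : ∀ n, ∑ i ∈ Finset.range (n + 1),
      γ i * ((f (x (i + 1)) + g (x (i + 1)) + ⟪x (i + 1), uu⟫ - Hv) -
      (f xx + g xx + ⟪xx, u (i + 1)⟫ - (⟪z (i + 1), u (i + 1)⟫ - h (z (i + 1))))) ≤
      (‖z 0 - xx‖ ^ 2 + γ 0 ^ 2 * ‖u 0 - uu‖ ^ 2) / 2 - ‖z (n + 1) - xx‖ ^ 2 / 2
        - γ n ^ 2 * ‖u (n + 1) - uu‖ ^ 2 / 2 - γ n * δ n := by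
    intro n
    induction n with
    | zero => 
      rw [Finset.sum_range_one]
      have := hone 0
      linarith
    | succ n ih =>
      rw [Finset.sum_range_succ]
      have h1 := hone (n + 1)
      have h2 := hst n
      linarith
  have hfin := hsum t
  have hgd : 0 ≤ γ t * δ t := mul_nonneg (hγpos t).le (hδpos t)
  have hp1 : 0 ≤ γ t ^ 2 * ‖u (t + 1) - uu‖ ^ 2 := by positivity
  have hp2 : 0 ≤ ‖z (t + 1) - xx‖ ^ 2 := by positivity
  have hS : 0 < ∑ i ∈ Finset.range (t + 1), γ i :=
    Finset.sum_pos (fun i _ => hγpos i) ⟨0, by simp⟩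
  set S := ∑ i ∈ Finset.range (t + 1), γ i with hSdef
  have hJ : ∀ F : EuclideanSpace ℝ (Fin p) → ℝ, ConvexOn ℝ Set.univ F →
      S * F (S⁻¹ • ∑ i ∈ Finset.range (t + 1), γ i • x (i + 1)) ≤
        ∑ i ∈ Finset.range (t + 1), γ i * F (x (i + 1)) := by
    intro F hF
    have := hF.map_centerMass_le (t := Finset.range (t + 1)) (w := γ) (p := fun i => x (i + 1))
      (fun i _ => (hγpos i).le) hS (fun i _ => Set.mem_univ _)
    simp only [Finset.centerMass, smul_eq_mul, ← hSdef, Function.comp] at this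
    have h2 := mul_le_mul_of_nonneg_left this hS.le
    rwa [mul_inv_cancel_left₀ hS.ne'] at h2
  have hJf := hJ f hf
  have hJg := hJ g hg
  have hinx : S * ⟪S⁻¹ • ∑ i ∈ Finset.range (t + 1), γ i • x (i + 1), uu⟫ =
      ∑ i ∈ Finset.range (t + 1), γ i * ⟪x (i + 1), uu⟫ := by
    rw [real_inner_smul_left, mul_inv_cancel_left₀ hS.ne', sum_inner]
    simp only [real_inner_smul_left]
  have hinu : ∀ y, S * ⟪y, S⁻¹ • ∑ i ∈ Finset.range (t + 1), γ i • u (i + 1)⟫ =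
      ∑ i ∈ Finset.range (t + 1), γ i * ⟪y, u (i + 1)⟫ := by
    intro y
    rw [real_inner_smul_right, mul_inv_cancel_left₀ hS.ne', inner_sum]
    simp only [real_inner_smul_right]
  have hconj : S * (fenchel h (S⁻¹ • ∑ i ∈ Finset.range (t + 1), γ i • u (i + 1))).toReal ≤
      ∑ i ∈ Finset.range (t + 1), γ i * (⟪z (i + 1), u (i + 1)⟫ - h (z (i + 1))) := by
    rw [← le_div_iff₀' hS]
    apply aux_fenchel_le
    intro y
    rw [le_div_iff₀' hS, mul_sub, hinu, hSdef, Finset.sum_mul, ← Finset.sum_sub_distrib]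
    refine Finset.sum_le_sum fun i _ => ?_
    rw [← mul_sub]
    exact mul_le_mul_of_nonneg_left (hsub i y) (hγpos i).le
  have hinxx := hinu xx
  have hexp : ∑ i ∈ Finset.range (t + 1),
      γ i * ((f (x (i + 1)) + g (x (i + 1)) + ⟪x (i + 1), uu⟫ - Hv) -
      (f xx + g xx + ⟪xx, u (i + 1)⟫ - (⟪z (i + 1), u (i + 1)⟫ - h (z (i + 1))))) =
      ∑ i ∈ Finset.range (t + 1), γ i * f (x (i + 1)) +
      ∑ i ∈ Finset.range (t + 1), γ i * g (x (i + 1)) +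
      ∑ i ∈ Finset.range (t + 1), γ i * ⟪x (i + 1), uu⟫ - S * Hv - S * f xx - S * g xx -
      ∑ i ∈ Finset.range (t + 1), γ i * ⟪xx, u (i + 1)⟫ +
      ∑ i ∈ Finset.range (t + 1), γ i * (⟪z (i + 1), u (i + 1)⟫ - h (z (i + 1))) := by
    rw [hSdef, Finset.sum_mul, Finset.sum_mul, Finset.sum_mul]
    simp only [← Finset.sum_sub_distrib, ← Finset.sum_add_distrib]
    exact Finset.sum_congr rfl fun i _ => by ring
  rw [hexp] at hfin
  rw [le_div_iff₀ (by positivity)]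
  unfold saddleL
  rw [← hHv]
  linarith
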